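/- Let (W, S) be a Coxeter system and r = w s w⁻¹ a reflection (a conjugate of a generator s ∈ S). Then the support of r (the set of generators appearing in a reduced expression of r) is irreducible, i.e., spans a connected subgraph of the Dynkin diagram. -/

import Mathlib

theorem Function.End.mul_apply {α : Type*} (f g : Function.End α) (a : α) :
    (f * g) a = f (g a) := rfl

namespace CoxeterMatrix

variable {B : Type*} (M : CoxeterMatrix B)

/-- The simple coroots of the geometric representation, as linear forms on `B →₀ ℝ`. -/
noncomputable def simpleCoroot (i : B) : Module.Dual ℝ (B →₀ ℝ) :=
  Finsupp.linearCombination ℝ fun j ↦ -2 * Real.cos (Real.pi / M i j)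

theorem simpleCoroot_single (i j : B) :
    M.simpleCoroot i (Finsupp.single j 1) = -2 * Real.cos (Real.pi / M i j) := by
  simp [simpleCoroot]

theorem simpleCoroot_single_self (i : B) : M.simpleCoroot i (Finsupp.single i 1) = 2 := by
  simp [simpleCoroot_single]

/-- The simple reflections of the geometric representation. -/
noncomputable def simpleReflection (i : B) : (B →₀ ℝ) ≃ₗ[ℝ] (B →₀ ℝ) :=
  Module.reflection (M.simpleCoroot_single_self i)

theorem isLiftable_simpleReflection : M.IsLiftable M.simpleReflection := by
  intro i j
  obtain rfl | hij := eq_or_ne i j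
  · rw [M.diagonal, pow_one]
    ext1 z
    exact Module.involutive_reflection (M.simpleCoroot_single_self i) z
  ext1 z
  have ht : 2 * Real.cos (2 * (Real.pi / M i j)) =
      M.simpleCoroot i (Finsupp.single j 1) * M.simpleCoroot j (Finsupp.single i 1) - 2 := by
    rw [simpleCoroot_single, simpleCoroot_single, M.symmetric j i, Real.cos_two_mul]
    ring
  rw [simpleReflection, simpleReflection,
    Module.reflection_mul_reflection_pow_apply _ _ _ _ _ ht]
  obtain h0 | h1 | h2 | h3 : M i j = 0 ∨ M i j = 1 ∨ M i j = 2 ∨ 3 ≤ M i j := by omega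
  · simp [h0]
  · exact absurd h1 (M.off_diagonal i j hij)
  · rw [h2]
    have hx : M.simpleCoroot j (Finsupp.single i 1) = 0 := by
      simp [simpleCoroot_single, M.symmetric j i, h2]
    have hy : M.simpleCoroot i (Finsupp.single j 1) = 0 := by
      simp [simpleCoroot_single, h2]
    have ht : 2 * Real.cos (2 * (Real.pi / ((2 : ℕ) : ℝ))) = -2 := by
      rw [show 2 * (Real.pi / ((2 : ℕ) : ℝ)) = Real.pi by push_cast; ring, Real.cos_pi]
      norm_num
    rw [ht, hx, hy]
    norm_num
    module
  · have hm : (0 : ℝ) < M i j := by exact_mod_cast (by omega : 0 < M i j)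
    have h3' : (3 : ℝ) ≤ M i j := by exact_mod_cast h3
    have hsin : Real.sin (2 * (Real.pi / M i j)) ≠ 0 := by
      apply ne_of_gt
      apply Real.sin_pos_of_pos_of_lt_pi
      · positivity
      · rw [← mul_div_assoc, div_lt_iff₀ hm]
        nlinarith [Real.pi_pos]
    have hS := Polynomial.Chebyshev.S_two_mul_real_cos (2 * (Real.pi / M i j))
    obtain ⟨k, hk | hk⟩ := Nat.even_or_odd' (M i j)
    · have e1 : (((M i j : ℕ) : ℤ) - 2) / 2 = k - 1 := by omega
      have e2 : (((M i j : ℕ) : ℤ) - 1) / 2 = k - 1 := by omega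
      have hz : (Polynomial.Chebyshev.S ℝ (k - 1)).eval
          (2 * Real.cos (2 * (Real.pi / M i j))) = 0 := by
        apply (mul_eq_zero.1 _).resolve_right hsin
        rw [hS, ← Real.sin_pi]
        congr 1
        rw [hk] at hm ⊢
        push_cast at hm ⊢
        have hk0 : (k : ℝ) ≠ 0 := by
          intro h
          simp [h] at hm
        field_simp
        ring
      rw [e1, e2, hz]
      simp
    · have e1 : (((M i j : ℕ) : ℤ) - 2) / 2 = k - 1 := by omega
      have e2 : (((M i j : ℕ) : ℤ) - 1) / 2 = k := by omega
      have e3 : (((M i j : ℕ) : ℤ) - 3) / 2 = k - 1 := by omega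
      have e4 : ((M i j : ℕ) : ℤ) / 2 = k := by omega
      have hz : (Polynomial.Chebyshev.S ℝ k).eval (2 * Real.cos (2 * (Real.pi / M i j))) +
          (Polynomial.Chebyshev.S ℝ (k - 1)).eval (2 * Real.cos (2 * (Real.pi / M i j))) = 0 := by
        apply (mul_eq_zero.1 _).resolve_right hsin
        rw [add_mul, hS, hS, add_eq_zero_iff_eq_neg, ← Real.sin_sub_two_pi, ← Real.sin_neg]
        congr 1
        rw [hk] at hm ⊢
        push_cast at hm ⊢
        field_simp
        ring
      rw [e1, e2, e3, e4, hz]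
      simp

end CoxeterMatrix

namespace CoxeterSystem

variable {B W : Type*} [Group W] {M : CoxeterMatrix B} (cs : CoxeterSystem M W)

theorem simple_injective : Function.Injective cs.simple := by
  intro i j h
  by_contra hij
  have h' := congrArg (cs.lift ⟨_, M.isLiftable_simpleReflection⟩) h
  rw [cs.lift_apply_simple, cs.lift_apply_simple] at h'
  have h'' := DFunLike.congr_fun (DFunLike.congr_fun h' (Finsupp.single i 1)) i
  rw [CoxeterMatrix.simpleReflection, CoxeterMatrix.simpleReflection, Module.reflection_apply_self,
    Module.reflection_apply] at h''
  simp [Ne.symm hij] at h''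
  norm_num at h''

open Classical in
/-- The action of a simple reflection on pairs of a group element and a parity: conjugate the
element and flip the parity exactly at the simple reflection itself. -/
noncomputable def parityStep (i : B) : Function.End (W × ZMod 2) := fun p ↦
  (cs.simple i * p.1 * cs.simple i, p.2 + if p.1 = cs.simple i then 1 else 0)

open Classical in
theorem parityStep_mul_pow_apply (i j : B) (n : ℕ) (t : W) (e : ZMod 2) :
    ((cs.parityStep i * cs.parityStep j) ^ n) (t, e) =
      ((cs.simple i * cs.simple j) ^ n * t * ((cs.simple i * cs.simple j) ^ n)⁻¹,
        e + ∑ k ∈ Finset.range (2 * n),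
          if t = (cs.simple j * cs.simple i) ^ k * cs.simple j then 1 else 0) := by
  induction n generalizing t e with
  | zero => simp [Function.End.one_def]
  | succ n ih =>
    have step : (cs.parityStep i * cs.parityStep j) (t, e) =
        (cs.simple i * (cs.simple j * t * cs.simple j) * cs.simple i,
          e + (if t = cs.simple j then 1 else 0) +
            if cs.simple j * t * cs.simple j = cs.simple i then 1 else 0) := rfl
    rw [pow_succ, Function.End.mul_apply, step, ih, Prod.mk.injEq]
    constructor
    · simp [pow_succ, mul_assoc]
    · rw [mul_add, mul_one, Finset.sum_range_succ', Finset.sum_range_succ']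
      have h1 : cs.simple j * t * cs.simple j = cs.simple i ↔
          t = (cs.simple j * cs.simple i) ^ (0 + 1) * cs.simple j := by
        constructor
        · intro h
          simp [← h, mul_assoc]
        · rintro rfl
          simp [mul_assoc]
      have h2 (k : ℕ) : cs.simple i * (cs.simple j * t * cs.simple j) * cs.simple i =
            (cs.simple j * cs.simple i) ^ k * cs.simple j ↔
          t = (cs.simple j * cs.simple i) ^ (k + 1 + 1) * cs.simple j := by
        constructor
        · intro h
          have : t = cs.simple j * (cs.simple i * (cs.simple i * (cs.simple j * t * cs.simple j) *
              cs.simple i) * cs.simple i) * cs.simple j := by simp [mul_assoc]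
          rw [this, h, pow_succ, pow_succ']
          simp [mul_assoc]
        · rintro rfl
          rw [pow_succ, pow_succ']
          simp [mul_assoc]
      simp only [h1, h2, pow_zero, one_mul]
      ring

theorem isLiftable_parityStep : M.IsLiftable cs.parityStep := by
  classical
  intro i j
  funext ⟨t, e⟩
  rw [parityStep_mul_pow_apply, two_mul, Finset.sum_range_add]
  simp [pow_add, CharTwo.add_self_eq_zero, Function.End.one_def]

/-- The parity of the multiplicity of `t` in the right inversion sequence of any word
representing `w`. -/
noncomputable def inversionParity (w t : W) : ZMod 2 :=
  (cs.lift ⟨_, cs.isLiftable_parityStep⟩ w (t, 0)).2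

open Classical in
theorem lift_parityStep_wordProd (ω : List B) (t : W) (e : ZMod 2) :
    cs.lift ⟨_, cs.isLiftable_parityStep⟩ (cs.wordProd ω) (t, e) =
      (cs.wordProd ω * t * (cs.wordProd ω)⁻¹, e + (cs.rightInvSeq ω).count t) := by
  induction ω with
  | nil => simp [Function.End.one_def]
  | cons i ω ih =>
    rw [wordProd_cons, map_mul, Function.End.mul_apply, ih, lift_apply_simple,
      parityStep, rightInvSeq, List.count_cons, Prod.mk.injEq]
    constructor
    · simp [mul_assoc]
    · have h : (cs.wordProd ω)⁻¹ * cs.simple i * cs.wordProd ω = t ↔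
          cs.wordProd ω * t * (cs.wordProd ω)⁻¹ = cs.simple i := by
        constructor
        · rintro rfl
          group
        · intro h
          rw [← h]
          group
      simp [h, add_assoc]

open Classical in
theorem inversionParity_wordProd (ω : List B) (t : W) :
    cs.inversionParity (cs.wordProd ω) t = (cs.rightInvSeq ω).count t := by
  simp [inversionParity, lift_parityStep_wordProd]

theorem inversionParity_mul (x y t : W) :
    cs.inversionParity (x * y) t =
      cs.inversionParity y t + cs.inversionParity x (y * t * y⁻¹) := by
  classical
  obtain ⟨α, rfl⟩ := cs.wordProd_surjective x
  obtain ⟨β, rfl⟩ := cs.wordProd_surjective y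
  rw [inversionParity, map_mul, Function.End.mul_apply,
    lift_parityStep_wordProd, lift_parityStep_wordProd, inversionParity_wordProd,
    inversionParity_wordProd, zero_add]

theorem inversionParity_one (t : W) : cs.inversionParity 1 t = 0 := by
  simp [inversionParity, Function.End.one_def]

theorem IsReflection.inversionParity_self {cs : CoxeterSystem M W} {t : W}
    (ht : cs.IsReflection t) : cs.inversionParity t t = 1 := by
  classical
  obtain ⟨u, i, rfl⟩ := ht
  have h := cs.inversionParity_mul u u⁻¹ (u * cs.simple i * u⁻¹)
  rw [mul_inv_cancel, inversionParity_one] at h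
  have hs : cs.inversionParity (cs.simple i) (cs.simple i) = 1 := by
    have := cs.inversionParity_wordProd [i] (cs.simple i)
    simpa using this
  have e : u⁻¹ * (u * cs.simple i * u⁻¹) * u⁻¹⁻¹ = cs.simple i := by group
  rw [e] at h
  rw [inversionParity_mul, inversionParity_mul, e, hs, mul_inv_cancel_right]
  linear_combination -h

theorem mem_rightInvSeq_iff {ω : List B} {t : W} :
    t ∈ cs.rightInvSeq ω ↔ ∃ α i β, ω = α ++ i :: β ∧
      t = (cs.wordProd β)⁻¹ * cs.simple i * cs.wordProd β := by
  induction ω with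
  | nil => simp
  | cons j ω ih =>
    rw [rightInvSeq, List.mem_cons, ih]
    constructor
    · rintro (rfl | ⟨α, i, β, rfl, rfl⟩)
      · exact ⟨[], j, ω, rfl, rfl⟩
      · exact ⟨j :: α, i, β, rfl, rfl⟩
    · rintro ⟨_ | ⟨a, α⟩, i, β, h, rfl⟩
      · obtain ⟨rfl, rfl⟩ := List.cons.inj h
        exact Or.inl rfl
      · obtain ⟨rfl, rfl⟩ := List.cons.inj h
        exact Or.inr ⟨α, i, β, rfl, rfl⟩

theorem mem_rightInvSeq_of_inversionParity_ne_zero {ω : List B} {t : W}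
    (h : cs.inversionParity (cs.wordProd ω) t ≠ 0) : t ∈ cs.rightInvSeq ω := by
  classical
  by_contra hn
  exact h (by rw [inversionParity_wordProd, List.count_eq_zero_of_not_mem hn, Nat.cast_zero])

theorem IsReduced.inversionParity_eq_one {cs : CoxeterSystem M W} {ω : List B}
    (hω : cs.IsReduced ω) {t : W} (ht : t ∈ cs.rightInvSeq ω) :
    cs.inversionParity (cs.wordProd ω) t = 1 := by
  classical
  rw [inversionParity_wordProd, List.count_eq_one_of_mem hω.nodup_rightInvSeq ht, Nat.cast_one]

theorem commute_simple {i j : B} (h : M i j = 2) : Commute (cs.simple i) (cs.simple j) := by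
  have := cs.simple_mul_simple_pow i j
  rw [h, pow_two, mul_eq_one_iff_eq_inv, mul_inv_rev, inv_simple, inv_simple] at this
  exact this

theorem commute_wordProd {x : W} {ω : List B} (h : ∀ i ∈ ω, Commute x (cs.simple i)) :
    Commute x (cs.wordProd ω) := by
  induction ω with
  | nil => simp
  | cons i ω ih =>
    rw [wordProd_cons]
    exact (h i (by simp)).mul_right (ih fun k hk ↦ h k (by simp [hk]))

/-- Conjugating a simple reflection by a word may omit the letters outside `C` when these
commute with all the letters in `C`. -/
theorem conj_wordProd_filter (C : B → Prop) [DecidablePred C] {i : B} (hi : C i) (ω : List B)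
    (h : ∀ b ∈ ω, ¬ C b → ∀ a ∈ i :: ω, C a → Commute (cs.simple b) (cs.simple a)) :
    (cs.wordProd ω)⁻¹ * cs.simple i * cs.wordProd ω =
      (cs.wordProd (ω.filter C))⁻¹ * cs.simple i * cs.wordProd (ω.filter C) := by
  induction ω using List.reverseRecOn with
  | nil => simp
  | append_singleton ω b ih =>
    have ih := ih fun b' hb' hC a ha ↦ h b' (by simp [hb']) hC a (by
      rcases List.mem_cons.1 ha with rfl | ha <;> simp [*])
    have e : (cs.wordProd (ω ++ [b]))⁻¹ * cs.simple i * cs.wordProd (ω ++ [b]) =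
        cs.simple b * ((cs.wordProd ω)⁻¹ * cs.simple i * cs.wordProd ω) * cs.simple b := by
      simp [wordProd_append, mul_assoc]
    rw [e, ih]
    by_cases hb : C b
    · simp [List.filter_append, hb, wordProd_append, mul_assoc]
    · have hc : Commute (cs.simple b) (cs.wordProd (ω.filter C)) := by
        refine cs.commute_wordProd fun a ha ↦ ?_
        obtain ⟨ha, haC⟩ := List.mem_filter.1 ha
        exact h b (by simp) hb a (by simp [ha]) (by simpa using haC)
      have hc' := (hc.inv_right.mul_right (h b (by simp) hb i (by simp) hi)).mul_right hc
      rw [hc'.eq]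
      simp [List.filter_append, hb]

/-- Let a reduced word represent a reflection that occurs in its own right inversion sequence at
the letter `i`. If `C` contains `i`, and the letters in `C` commute with those outside `C`, then all
letters of the word are in `C`. -/
theorem IsReduced.forall_mem_of_isReflection {cs : CoxeterSystem M W} {α β : List B} {i : B}
    (hred : cs.IsReduced (α ++ i :: β)) (hr : cs.IsReflection (cs.wordProd (α ++ i :: β)))
    (hi : cs.wordProd (α ++ i :: β) = (cs.wordProd β)⁻¹ * cs.simple i * cs.wordProd β)
    (C : B → Prop) (hC : C i)
    (hcomm : ∀ a ∈ α ++ i :: β, ∀ b ∈ α ++ i :: β, C a → ¬ C b → M a b = 2) :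
    ∀ j ∈ α ++ i :: β, C j := by
  classical
  have hcomm' : ∀ b ∈ α ++ i :: β, ¬ C b → ∀ a ∈ α ++ i :: β, C a →
      Commute (cs.simple b) (cs.simple a) := fun b hb hCb a ha hCa ↦
    (cs.commute_simple (hcomm a ha b hb hCa hCb)).symm
  have hword : cs.wordProd (α ++ i :: β) =
      cs.wordProd ((β.filter C).reverse ++ i :: β.filter C) := by
    rw [hi, cs.conj_wordProd_filter C hC β fun b hb hCb a ha ↦ hcomm' b (by simp [hb]) hCb a (by
      rcases List.mem_cons.1 ha with rfl | ha <;> simp [*])]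
    simp [wordProd_append, wordProd_cons, mul_assoc]
  have hmem : ∀ a ∈ (β.filter C).reverse ++ i :: β.filter C, a ∈ α ++ i :: β ∧ C a := by
    intro a ha
    have : (a ∈ β ∧ C a) ∨ a = i := by
      simp at ha
      tauto
    rcases this with ⟨h, h'⟩ | rfl
    · exact ⟨by simp [h], h'⟩
    · exact ⟨by simp, hC⟩
  generalize (β.filter C).reverse ++ i :: β.filter C = γ at hword hmem
  generalize α ++ i :: β = ω at *
  by_contra! hne
  obtain ⟨ω₁, j, ω₂, rfl, hj, hω₂⟩ : ∃ ω₁ j ω₂, ω = ω₁ ++ j :: ω₂ ∧ ¬ C j ∧ ∀ a ∈ ω₂, C a := by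
    clear * - hne
    induction ω with
    | nil => simp at hne
    | cons k ω ih =>
      by_cases h : ∃ j ∈ ω, ¬ C j
      · obtain ⟨ω₁, j, ω₂, rfl, hj, hω₂⟩ := ih h
        exact ⟨k :: ω₁, j, ω₂, rfl, hj, hω₂⟩
      · push Not at h
        obtain ⟨j, hj, hCj⟩ := hne
        rcases List.mem_cons.1 hj with rfl | hj
        · exact ⟨[], j, ω, rfl, hCj, h⟩
        · exact absurd (h j hj) hCj
  have hjω : cs.simple j ∈ cs.rightInvSeq (ω₁ ++ j :: ω₂) := by
    refine cs.mem_rightInvSeq_iff.2 ⟨ω₁, j, ω₂, rfl, ?_⟩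
    have hc : Commute (cs.simple j) (cs.wordProd ω₂) :=
      cs.commute_wordProd fun a ha ↦ hcomm' j (by simp) hj a (by simp [ha]) (hω₂ a ha)
    rw [mul_assoc, hc.eq, inv_mul_cancel_left]
  have hpar := hred.inversionParity_eq_one hjω
  rw [hword] at hpar
  have hjγ := cs.mem_rightInvSeq_of_inversionParity_ne_zero (hpar.trans_ne one_ne_zero)
  obtain ⟨γ₁, k, γ₂, rfl, hk⟩ := cs.mem_rightInvSeq_iff.1 hjγ
  have hc : Commute (cs.simple j) (cs.wordProd γ₂) := cs.commute_wordProd fun a ha ↦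
    have ha' := hmem a (by simp [ha])
    hcomm' j (by simp) hj a ha'.1 ha'.2
  have hjk : cs.simple j = cs.simple k := by
    rw [mul_assoc, eq_inv_mul_iff_mul_eq, ← hc.eq] at hk
    exact mul_right_cancel hk
  exact hj (cs.simple_injective hjk ▸ (hmem k (by simp)).2)

end CoxeterSystem

/-- **Lemma 2.1.** The support of a reflection in a Coxeter group is irreducible: the set of
letters of any reduced word representing a reflection spans a connected subgraph of the
Dynkin diagram (whose edges join non-commuting pairs of generators). -/
theorem reflection_support_irreducible {B W : Type*} [Group W]
    {M : CoxeterMatrix B} (cs : CoxeterSystem M W)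
    (r : W) (hr : cs.IsReflection r)
    (w : List B) (hred : cs.IsReduced w) (hw : cs.wordProd w = r) :
    (SimpleGraph.induce {i : B | i ∈ w}
      (SimpleGraph.fromRel (fun i j : B => M i j ≠ 2))).Connected := by
  subst hw
  have hmem := cs.mem_rightInvSeq_of_inversionParity_ne_zero
    (hr.inversionParity_self.trans_ne one_ne_zero)
  obtain ⟨α, i, β, rfl, hi⟩ := cs.mem_rightInvSeq_iff.1 hmem
  have hiw : i ∈ α ++ i :: β := by simp
  rw [SimpleGraph.connected_iff_exists_forall_reachable]
  refine ⟨⟨i, hiw⟩, fun ⟨j, hj⟩ ↦ ?_⟩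
  obtain ⟨x, hx, h⟩ := hred.forall_mem_of_isReflection hr hi
    (fun j ↦ ∃ x : {k : B | k ∈ α ++ i :: β}, x.1 = j ∧ SimpleGraph.Reachable (SimpleGraph.induce
      {k : B | k ∈ α ++ i :: β} (SimpleGraph.fromRel (fun i j : B => M i j ≠ 2)))
      ⟨i, hiw⟩ x) ⟨_, rfl, .rfl⟩ (by
        rintro _ - b hb ⟨x, rfl, hreach⟩ hb'
        by_contra hab
        refine hb' ⟨⟨b, hb⟩, rfl, hreach.trans ?_⟩
        by_cases h : x.1 = b
        · obtain rfl : x = ⟨b, hb⟩ := Subtype.ext h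
          rfl
        · apply SimpleGraph.Adj.reachable
          simp [h, hab]) j hj
  obtain rfl : x = ⟨j, hj⟩ := Subtype.ext hx
  exact h
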